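/- Let E be a nonempty subset of ℝ^n. The following are equivalent: (1) E is a closed ambitropical cone; (2) E is a set of existence of best tropical co-approximation, i.e., for every z ∈ ℝ^n, B_E(z) ∩ E ≠ ∅, where B_E(z) = ⋂_{y∈E}{x : y + b(z−y) ≤ x ≤ y + t(z−y)}; (3) for every z ∈ ℝ^n, the order interval [P^max_E(z), P^min_E(z)] meets E; (4) P^min_E(z) ∈ E for all z ∈ E^max; (5) P^max_E(z) ∈ E for all z ∈ E^min; (6) E is the fixed point set of P^max_E ∘ P^min_E; (7) E is the fixed point set of P^min_E ∘ P^max_E. -/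

import Mathlib

open Set Filter Topology

namespace Ambitropical

variable {n : ℕ}

/-- An additive cone of `ℝ^n`: a set stable by the addition of a real constant
to every coordinate. -/
def AdditiveCone (C : Set (Fin n → ℝ)) : Prop :=
  ∀ x ∈ C, ∀ l : ℝ, (fun i => l + x i) ∈ C

/-- `z` is the least upper bound, *within* `C`, of the subset `X`. -/
def IsLubWithin (C X : Set (Fin n → ℝ)) (z : Fin n → ℝ) : Prop :=
  z ∈ C ∧ (∀ x ∈ X, x ≤ z) ∧ ∀ w ∈ C, (∀ x ∈ X, x ≤ w) → z ≤ w

/-- `z` is the greatest lower bound, *within* `C`, of the subset `X`. -/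
def IsGlbWithin (C X : Set (Fin n → ℝ)) (z : Fin n → ℝ) : Prop :=
  z ∈ C ∧ (∀ x ∈ X, z ≤ x) ∧ ∀ w ∈ C, (∀ x ∈ X, w ≤ x) → w ≤ z

/-- An ambitropical cone: a nonempty additive cone of `ℝ^n` that is a lattice in
the induced (componentwise) partial order. -/
def IsAmbitropicalCone (C : Set (Fin n → ℝ)) : Prop :=
  C.Nonempty ∧ AdditiveCone C ∧
    ∀ x ∈ C, ∀ y ∈ C, (∃ z, IsLubWithin C {x, y} z) ∧ ∃ z, IsGlbWithin C {x, y} z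

/-- A (abstract) Shapley operator: order preserving and commuting with the
addition of a constant. -/
def IsShapley {n p : ℕ} (T : (Fin n → ℝ) → (Fin p → ℝ)) : Prop :=
  Monotone T ∧ ∀ (l : ℝ) (x : Fin n → ℝ), T (fun i => l + x i) = fun i => l + T x i

/-- `E^max`: the set of componentwise suprema of bounded-above families
`(λ_f + f)_{f ∈ E}` with `λ_f ∈ ℝ ∪ {-∞}`, not all `-∞` (the subfamily with
finite coefficients is encoded by a nonempty subset `S` of `E`). -/
def MaxGen (E : Set (Fin n → ℝ)) : Set (Fin n → ℝ) :=
  {x | ∃ S : Set (Fin n → ℝ), S ⊆ E ∧ S.Nonempty ∧ ∃ lam : (Fin n → ℝ) → ℝ,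
      (∃ u : Fin n → ℝ, ∀ f ∈ S, (fun i => lam f + f i) ≤ u) ∧
      ∀ i, IsLUB {v : ℝ | ∃ f ∈ S, v = lam f + f i} (x i)}

/-- `E^min`: the set of componentwise infima of bounded-below families
`(μ_f + f)_{f ∈ E}` with `μ_f ∈ ℝ ∪ {+∞}`, not all `+∞`. -/
def MinGen (E : Set (Fin n → ℝ)) : Set (Fin n → ℝ) :=
  {x | ∃ S : Set (Fin n → ℝ), S ⊆ E ∧ S.Nonempty ∧ ∃ mu : (Fin n → ℝ) → ℝ,
      (∃ u : Fin n → ℝ, ∀ f ∈ S, u ≤ (fun i => mu f + f i)) ∧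
      ∀ i, IsGLB {v : ℝ | ∃ f ∈ S, v = mu f + f i} (x i)}

/-- `P` is the tropical projection `P^max_E`, i.e. `P z = sup {y ∈ E^max ∣ y ≤ z}`. -/
def IsPmaxMap (E : Set (Fin n → ℝ)) (P : (Fin n → ℝ) → Fin n → ℝ) : Prop :=
  ∀ z, IsLUB {y | y ∈ MaxGen E ∧ y ≤ z} (P z)

/-- `P` is the dual tropical projection `P^min_E`, i.e. `P z = inf {y ∈ E^min ∣ z ≤ y}`. -/
def IsPminMap (E : Set (Fin n → ℝ)) (P : (Fin n → ℝ) → Fin n → ℝ) : Prop :=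
  ∀ z, IsGLB {y | y ∈ MinGen E ∧ z ≤ y} (P z)

/-- `Q` is the canonical retraction `Q_C^-`, i.e. `Q x = sup^C {y ∈ C ∣ y ≤ x}`. -/
def IsQminusMap (C : Set (Fin n → ℝ)) (Q : (Fin n → ℝ) → Fin n → ℝ) : Prop :=
  ∀ x, IsLubWithin C {y ∈ C | y ≤ x} (Q x)

/-- `Q` is the canonical retraction `Q_C^+`, i.e. `Q x = inf^C {y ∈ C ∣ x ≤ y}`. -/
def IsQplusMap (C : Set (Fin n → ℝ)) (Q : (Fin n → ℝ) → Fin n → ℝ) : Prop :=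
  ∀ x, IsGlbWithin C {y ∈ C | x ≤ y} (Q x)

/-- A tropical cone: an additive cone stable by componentwise max. -/
def TropicalCone (C : Set (Fin n → ℝ)) : Prop :=
  AdditiveCone C ∧ ∀ x ∈ C, ∀ y ∈ C, x ⊔ y ∈ C

/-- A dual tropical cone: an additive cone stable by componentwise min. -/
def DualTropicalCone (C : Set (Fin n → ℝ)) : Prop :=
  AdditiveCone C ∧ ∀ x ∈ C, ∀ y ∈ C, x ⊓ y ∈ C

/-- `t(u) = max_i u_i`. -/
noncomputable def tmax (u : Fin n → ℝ) : ℝ := ⨆ i, u i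

/-- `b(u) = min_i u_i`. -/
noncomputable def bmin (u : Fin n → ℝ) : ℝ := ⨅ i, u i

/-- An alcoved polyhedron: a set of the form
`{x ∣ x_i ≥ M_ij + x_j}` with `M_ij ∈ ℝ ∪ {-∞}` (constraints with `M_ij = -∞`
are vacuous, as `⊥ + x_j = ⊥` in `WithBot ℝ`). -/
def IsAlcoved (C : Set (Fin n → ℝ)) : Prop :=
  ∃ M : Fin n → Fin n → WithBot ℝ,
    C = {x | ∀ i j, M i j + (x j : WithBot ℝ) ≤ (x i : WithBot ℝ)}

/-- A homogeneous subset of `ℝ^n`: stable by multiplication by positive scalars. -/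
def HomogeneousSet (C : Set (Fin n → ℝ)) : Prop :=
  ∀ α : ℝ, 0 < α → ∀ x ∈ C, α • x ∈ C

/-- A (positively) homogeneous operator. -/
def HomogeneousMap (T : (Fin n → ℝ) → Fin n → ℝ) : Prop :=
  ∀ α : ℝ, 0 < α → ∀ x : Fin n → ℝ, T (α • x) = α • T x

/-- A finitely generated Shapley operator `T = A^♯ ∘ B` for a proper pair of
matrices `A, B` with entries in `ℝ ∪ {-∞}`:
`T_i(x) = min_{j : A_{ji} ≠ -∞} ( -A_{ji} + max_{k : B_{jk} ≠ -∞} (B_{jk} + x_k) )`. -/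
def FgShapley {n : ℕ} (T : (Fin n → ℝ) → Fin n → ℝ) : Prop :=
  ∃ (m : ℕ) (A B : Fin m → Fin n → WithBot ℝ),
    (∀ i : Fin n, ∃ j : Fin m, A j i ≠ ⊥) ∧
    (∀ j : Fin m, ∃ k : Fin n, B j k ≠ ⊥) ∧
    ∀ (x : Fin n → ℝ) (i : Fin n),
      T x i = sInf {v : ℝ | ∃ (j : Fin m) (a : ℝ), A j i = (a : WithBot ℝ) ∧
        v = -a + sSup {w : ℝ | ∃ (k : Fin n) (b : ℝ), B j k = (b : WithBot ℝ) ∧ w = b + x k}}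

theorem bmin_le' (u : Fin n → ℝ) (i : Fin n) : bmin u ≤ u i :=
  ciInf_le (Set.finite_range u).bddBelow i

theorem le_tmax' (u : Fin n → ℝ) (i : Fin n) : u i ≤ tmax u :=
  le_ciSup (Set.finite_range u).bddAbove i

section maxside
variable {E : Set (Fin n → ℝ)} {P : (Fin n → ℝ) → Fin n → ℝ}

theorem maxF1 (h : IsPmaxMap E P) {y : Fin n → ℝ} (hy : y ∈ E) {l : ℝ} {z : Fin n → ℝ}
    (hz : (fun i => l + y i) ≤ z) : (fun i => l + y i) ≤ P z := by
  apply (h z).1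
  refine ⟨⟨{y}, by simpa using hy, by simp, fun _ => l, ⟨fun i => l + y i, ?_⟩, ?_⟩, hz⟩
  · intro f hf
    rw [Set.mem_singleton_iff] at hf
    rw [hf]
  · intro i
    simp [isLUB_singleton]

theorem maxF2 (h : IsPmaxMap E P) {z x : Fin n → ℝ}
    (hx : ∀ y ∈ E, ∀ l : ℝ, (fun i => l + y i) ≤ z → (fun i => l + y i) ≤ x) : P z ≤ x := by
  apply (h z).2
  rintro w ⟨⟨S, hS, -, lam, -, hl⟩, hw⟩ i
  apply (hl i).2
  rintro v ⟨f, hf, rfl⟩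
  refine hx f (hS hf) (lam f) (fun j => le_trans ((hl j).1 ⟨f, hf, rfl⟩) (hw j)) i

theorem maxF3 (h : IsPmaxMap E P) (z : Fin n → ℝ) : P z ≤ z :=
  maxF2 h fun _ _ _ hl => hl

theorem maxMono (h : IsPmaxMap E P) : Monotone P := fun _ _ hab =>
  maxF2 h fun _ hy _ hl => maxF1 h hy (hl.trans hab)

theorem maxF4 (h : IsPmaxMap E P) {z : Fin n → ℝ} (hz : z ∈ MaxGen E) : P z = z :=
  le_antisymm (maxF3 h z) ((h z).1 ⟨hz, le_rfl⟩)

theorem maxF6 (h : IsPmaxMap E P) {z : Fin n → ℝ} (hz : z ∈ E) : P z = z := by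
  have := maxF1 h hz (l := 0) (z := z) (by simp)
  exact le_antisymm (maxF3 h z) (by simpa using this)

theorem maxF5 (hn : 0 < n) (hE : E.Nonempty) (h : IsPmaxMap E P) (z : Fin n → ℝ) :
    P z ∈ MaxGen E := by
  haveI : Nonempty (Fin n) := ⟨⟨0, hn⟩⟩
  have key : ∀ y : Fin n → ℝ, (fun i => bmin (z - y) + y i) ≤ z := by
    intro y i
    have := bmin_le' (z - y) i
    simp only [Pi.sub_apply] at this
    linarith
  refine ⟨E, subset_rfl, hE, fun y => bmin (z - y), ⟨z, fun f _ => key f⟩, fun i => ⟨?_, ?_⟩⟩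
  · rintro v ⟨f, hf, rfl⟩
    exact maxF1 h hf (key f) i
  · intro c hc
    have : P z ≤ fun j => if j = i then c else P z j := by
      apply maxF2 h
      intro y hy l hl j
      by_cases hj : j = i
      · subst hj
        have h1 : l ≤ bmin (z - y) := le_ciInf fun k => by
          have := hl k
          simp only [Pi.sub_apply] at *
          linarith
        have h2 := hc ⟨y, hy, rfl⟩
        simp only [if_true]
        linarith
      · simp only [if_neg hj]
        exact maxF1 h hy hl j
    simpa using this i

theorem max_iff (hn : 0 < n) (h : IsPmaxMap E P) (z x : Fin n → ℝ) :
    P z ≤ x ↔ ∀ y ∈ E, (fun i => bmin (z - y) + y i) ≤ x := by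
  haveI : Nonempty (Fin n) := ⟨⟨0, hn⟩⟩
  constructor
  · intro hx y hy
    refine le_trans (maxF1 h hy fun i => ?_) hx
    have := bmin_le' (z - y) i
    simp only [Pi.sub_apply] at this
    linarith
  · intro hx
    apply maxF2 h
    intro y hy l hl j
    have h1 : l ≤ bmin (z - y) := le_ciInf fun k => by
      have := hl k
      simp only [Pi.sub_apply] at *
      linarith
    have := hx y hy j
    simp only at *
    linarith

end maxside

section minside
variable {E : Set (Fin n → ℝ)} {P : (Fin n → ℝ) → Fin n → ℝ}

theorem minF1 (h : IsPminMap E P) {y : Fin n → ℝ} (hy : y ∈ E) {l : ℝ} {z : Fin n → ℝ}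
    (hz : z ≤ (fun i => l + y i)) : P z ≤ (fun i => l + y i) := by
  apply (h z).1
  refine ⟨⟨{y}, by simpa using hy, by simp, fun _ => l, ⟨fun i => l + y i, ?_⟩, ?_⟩, hz⟩
  · intro f hf
    rw [Set.mem_singleton_iff] at hf
    rw [hf]
  · intro i
    simp [isGLB_singleton]

theorem minF2 (h : IsPminMap E P) {z x : Fin n → ℝ}
    (hx : ∀ y ∈ E, ∀ l : ℝ, z ≤ (fun i => l + y i) → x ≤ (fun i => l + y i)) : x ≤ P z := by
  apply (h z).2
  rintro w ⟨⟨S, hS, -, lam, -, hl⟩, hw⟩ i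
  apply (hl i).2
  rintro v ⟨f, hf, rfl⟩
  refine hx f (hS hf) (lam f) (fun j => le_trans (hw j) ((hl j).1 ⟨f, hf, rfl⟩)) i

theorem minF3 (h : IsPminMap E P) (z : Fin n → ℝ) : z ≤ P z :=
  minF2 h fun _ _ _ hl => hl

theorem minMono (h : IsPminMap E P) : Monotone P := fun _ _ hab =>
  minF2 h fun _ hy _ hl => minF1 h hy (hab.trans hl)

theorem minF4 (h : IsPminMap E P) {z : Fin n → ℝ} (hz : z ∈ MinGen E) : P z = z :=
  le_antisymm ((h z).1 ⟨hz, le_rfl⟩) (minF3 h z)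

theorem minF6 (h : IsPminMap E P) {z : Fin n → ℝ} (hz : z ∈ E) : P z = z := by
  have := minF1 h hz (l := 0) (z := z) (by simp)
  exact le_antisymm (by simpa using this) (minF3 h z)

theorem minF5 (hn : 0 < n) (hE : E.Nonempty) (h : IsPminMap E P) (z : Fin n → ℝ) :
    P z ∈ MinGen E := by
  haveI : Nonempty (Fin n) := ⟨⟨0, hn⟩⟩
  have key : ∀ y : Fin n → ℝ, z ≤ (fun i => tmax (z - y) + y i) := by
    intro y i
    have := le_tmax' (z - y) i
    simp only [Pi.sub_apply] at this
    linarith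
  refine ⟨E, subset_rfl, hE, fun y => tmax (z - y), ⟨z, fun f _ => key f⟩, fun i => ⟨?_, ?_⟩⟩
  · rintro v ⟨f, hf, rfl⟩
    exact minF1 h hf (key f) i
  · intro c hc
    have : (fun j => if j = i then c else P z j) ≤ P z := by
      apply minF2 h
      intro y hy l hl j
      by_cases hj : j = i
      · subst hj
        have h1 : tmax (z - y) ≤ l := ciSup_le fun k => by
          have := hl k
          simp only [Pi.sub_apply] at *
          linarith
        have h2 := hc ⟨y, hy, rfl⟩
        simp only [if_true]
        linarith
      · simp only [if_neg hj]
        exact minF1 h hy hl j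
    simpa using this i

theorem min_iff (hn : 0 < n) (h : IsPminMap E P) (z x : Fin n → ℝ) :
    x ≤ P z ↔ ∀ y ∈ E, x ≤ (fun i => tmax (z - y) + y i) := by
  haveI : Nonempty (Fin n) := ⟨⟨0, hn⟩⟩
  constructor
  · intro hx y hy
    refine le_trans hx (minF1 h hy fun i => ?_)
    have := le_tmax' (z - y) i
    simp only [Pi.sub_apply] at this
    linarith
  · intro hx
    apply minF2 h
    intro y hy l hl j
    have h1 : tmax (z - y) ≤ l := ciSup_le fun k => by
      have := hl k
      simp only [Pi.sub_apply] at *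
      linarith
    have := hx y hy j
    simp only at *
    linarith

end minside

/-- Conditional completeness of a closed ambitropical cone. -/
theorem exists_between (E : Set (Fin n → ℝ)) (h : IsAmbitropicalCone E) (hc : IsClosed E)
    (z : Fin n → ℝ) : ∃ x ∈ E, (∀ y ∈ E, y ≤ z → y ≤ x) ∧ (∀ y ∈ E, z ≤ y → x ≤ y) := by
  obtain ⟨⟨e, he⟩, hadd, hlat⟩ := h
  obtain ⟨m, hm⟩ := (Set.finite_range (z - e)).bddAbove
  obtain ⟨m', hm'⟩ := (Set.finite_range (z - e)).bddBelow
  let D : Set (Fin n → ℝ) := {d | d ∈ E ∧ ∀ b ∈ E, (∀ y ∈ E, y ≤ z → y ≤ b) → d ≤ b}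
  have hAD : ∀ y ∈ E, y ≤ z → y ∈ D := fun y hy hyz => ⟨hy, fun b _ hb' => hb' y hy hyz⟩
  have hlow : (fun i => m' + e i) ∈ D := hAD _ (hadd e he m') fun i => by
    have := hm' ⟨i, rfl⟩
    simp only [Pi.sub_apply] at this
    linarith
  have hupE : (fun i => m + e i) ∈ E := hadd e he m
  have hup : z ≤ (fun i => m + e i) := fun i => by
    have := hm ⟨i, rfl⟩
    simp only [Pi.sub_apply] at this
    linarith
  haveI : Nonempty D := ⟨⟨_, hlow⟩⟩
  haveI : IsDirectedOrder D := ⟨by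
    rintro ⟨a, ha⟩ ⟨b, hb⟩
    obtain ⟨w, hw, hw1, hw2⟩ := (hlat a ha.1 b hb.1).1
    refine ⟨⟨w, hw, fun c hcE hc' => hw2 c hcE ?_⟩, hw1 a (by simp), hw1 b (by simp)⟩
    rintro x (rfl | rfl)
    · exact ha.2 c hcE hc'
    · exact hb.2 c hcE hc'⟩
  have hbd : ∀ i, BddAbove (Set.range fun d : D => (d : Fin n → ℝ) i) := fun i =>
    ⟨m + e i, by
      rintro _ ⟨d, rfl⟩
      exact d.2.2 _ hupE (fun y _ hyz => hyz.trans hup) i⟩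
  have ht : Tendsto (fun d : D => (d : Fin n → ℝ)) atTop
      (𝓝 fun i => ⨆ d : D, (d : Fin n → ℝ) i) := by
    rw [tendsto_pi_nhds]
    intro i
    exact tendsto_atTop_ciSup (fun a b hab => hab i) (hbd i)
  refine ⟨_, hc.mem_of_tendsto ht (Eventually.of_forall fun d => d.2.1), ?_, ?_⟩
  · intro y hy hyz i
    exact le_ciSup (hbd i) (⟨y, hAD y hy hyz⟩ : D)
  · intro y hy hyz i
    exact ciSup_le fun d => d.2.2 y hy (fun a _ haz => haz.trans hyz) i

/-- For a nonempty `E ⊆ ℝ^n`, the following are equivalent: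
(1) `E` is a closed ambitropical cone;
(2) `E` is a set of existence of best tropical co-approximation: `B_E(z) ∩ E ≠ ∅`
for all `z`;
(3) the order interval `[P^max_E(z), P^min_E(z)]` meets `E` for all `z`;
(4) `P^min_E(z) ∈ E` for all `z ∈ E^max`;
(5) `P^max_E(z) ∈ E` for all `z ∈ E^min`;
(6) `E` is the fixed point set of `P^max_E ∘ P^min_E`;
(7) `E` is the fixed point set of `P^min_E ∘ P^max_E`. -/
theorem closed_ambitropical_best_coapproximation_tfae {n : ℕ} (hn : 0 < n)
    (E : Set (Fin n → ℝ)) (hE : E.Nonempty)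
    (Pmax Pmin : (Fin n → ℝ) → Fin n → ℝ)
    (hPmax : IsPmaxMap E Pmax) (hPmin : IsPminMap E Pmin) :
    ((IsAmbitropicalCone E ∧ IsClosed E) ↔
      ∀ z : Fin n → ℝ, ∃ x ∈ E, ∀ y ∈ E,
        (fun i => bmin (z - y) + y i) ≤ x ∧ x ≤ fun i => tmax (z - y) + y i) ∧
    ((IsAmbitropicalCone E ∧ IsClosed E) ↔
      ∀ z : Fin n → ℝ, ∃ x ∈ E, Pmax z ≤ x ∧ x ≤ Pmin z) ∧
    ((IsAmbitropicalCone E ∧ IsClosed E) ↔ ∀ z ∈ MaxGen E, Pmin z ∈ E) ∧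
    ((IsAmbitropicalCone E ∧ IsClosed E) ↔ ∀ z ∈ MinGen E, Pmax z ∈ E) ∧
    ((IsAmbitropicalCone E ∧ IsClosed E) ↔ {x | Pmax (Pmin x) = x} = E) ∧
    ((IsAmbitropicalCone E ∧ IsClosed E) ↔ {x | Pmin (Pmax x) = x} = E) := by
  have h23 : (∀ z : Fin n → ℝ, ∃ x ∈ E, ∀ y ∈ E,
        (fun i => bmin (z - y) + y i) ≤ x ∧ x ≤ fun i => tmax (z - y) + y i) ↔
      ∀ z : Fin n → ℝ, ∃ x ∈ E, Pmax z ≤ x ∧ x ≤ Pmin z := by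
    simp only [max_iff hn hPmax, min_iff hn hPmin, ← forall_and]
  have h13 : (IsAmbitropicalCone E ∧ IsClosed E) →
      ∀ z : Fin n → ℝ, ∃ x ∈ E, Pmax z ≤ x ∧ x ≤ Pmin z := by
    rintro ⟨h, hc⟩ z
    obtain ⟨x, hx, h1, h2⟩ := exists_between E h hc z
    exact ⟨x, hx, maxF2 hPmax fun y hy l hl => h1 _ (h.2.1 y hy l) hl,
      minF2 hPmin fun y hy l hl => h2 _ (h.2.1 y hy l) hl⟩
  have h31 : (∀ z : Fin n → ℝ, ∃ x ∈ E, Pmax z ≤ x ∧ x ≤ Pmin z) →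
      (IsAmbitropicalCone E ∧ IsClosed E) := by
    intro h
    have hfix : ∀ z, z ≤ Pmax z → Pmin z ≤ z → z ∈ E := by
      intro z h1 h2
      obtain ⟨x, hx, h3, h4⟩ := h z
      have : x = z := le_antisymm (h4.trans h2) (h1.trans h3)
      exact this ▸ hx
    have a1 : ∀ y ∈ E, ∀ z, y ≤ z → y ≤ Pmax z := by
      intro y hy z hyz
      have := maxMono hPmax hyz
      rwa [maxF6 hPmax hy] at this
    have a2 : ∀ y ∈ E, ∀ z, z ≤ y → Pmin z ≤ y := by
      intro y hy z hyz
      have := minMono hPmin hyz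
      rwa [minF6 hPmin hy] at this
    refine ⟨⟨hE, fun x hx l => hfix _ (maxF1 hPmax hx le_rfl) (minF1 hPmin hx le_rfl),
      fun x hx y hy => ⟨?_, ?_⟩⟩, ?_⟩
    · obtain ⟨w, hw, h1, h2⟩ := h (x ⊔ y)
      refine ⟨w, hw, ?_, ?_⟩
      · rintro u (rfl | rfl)
        · exact (a1 _ hx _ le_sup_left).trans h1
        · exact (a1 _ hy _ le_sup_right).trans h1
      · intro u hu hxy
        exact h2.trans (a2 u hu _ (sup_le (hxy x (by simp)) (hxy y (by simp))))
    · obtain ⟨w, hw, h1, h2⟩ := h (x ⊓ y)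
      refine ⟨w, hw, ?_, ?_⟩
      · rintro u (rfl | rfl)
        · exact h2.trans (a2 _ hx _ inf_le_left)
        · exact h2.trans (a2 _ hy _ inf_le_right)
      · intro u hu hxy
        exact (a1 u hu _ (le_inf (hxy x (by simp)) (hxy y (by simp)))).trans h1
    · apply isClosed_of_closure_subset
      intro z hz
      rw [Metric.mem_closure_iff] at hz
      have key : ∀ ε > 0, ∃ y ∈ E, ∀ i, |z i - y i| ≤ ε := by
        intro ε hε
        obtain ⟨y, hy, hd⟩ := hz ε hε
        refine ⟨y, hy, fun i => ?_⟩
        rw [← Real.dist_eq]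
        exact (dist_le_pi_dist z y i).trans hd.le
      apply hfix
      · intro i
        apply le_of_forall_pos_le_add
        intro ε hε
        obtain ⟨y, hy, hd⟩ := key (ε / 2) (by linarith)
        have := maxF1 hPmax hy (l := -(ε / 2)) (z := z) (fun j => by
          have := abs_le.1 (hd j)
          simp only
          linarith) i
        have h2 := abs_le.1 (hd i)
        simp only at this
        linarith
      · intro i
        apply le_of_forall_pos_le_add
        intro ε hε
        obtain ⟨y, hy, hd⟩ := key (ε / 2) (by linarith)
        have := minF1 hPmin hy (l := ε / 2) (z := z) (fun j => by
          have := abs_le.1 (hd j)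
          simp only
          linarith) i
        have h2 := abs_le.1 (hd i)
        simp only at this
        linarith
  have e13 : (IsAmbitropicalCone E ∧ IsClosed E) ↔
      ∀ z : Fin n → ℝ, ∃ x ∈ E, Pmax z ≤ x ∧ x ≤ Pmin z := ⟨h13, h31⟩
  have e34 : (∀ z : Fin n → ℝ, ∃ x ∈ E, Pmax z ≤ x ∧ x ≤ Pmin z) ↔
      ∀ z ∈ MaxGen E, Pmin z ∈ E := by
    constructor
    · intro h z hz
      obtain ⟨x, hx, h1, h2⟩ := h z
      rw [maxF4 hPmax hz] at h1
      have h3 := minMono hPmin h1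
      rw [minF6 hPmin hx] at h3
      exact le_antisymm h2 h3 ▸ hx
    · intro h z
      exact ⟨_, h _ (maxF5 hn hE hPmax z), minF3 hPmin _, minMono hPmin (maxF3 hPmax z)⟩
  have e35 : (∀ z : Fin n → ℝ, ∃ x ∈ E, Pmax z ≤ x ∧ x ≤ Pmin z) ↔
      ∀ z ∈ MinGen E, Pmax z ∈ E := by
    constructor
    · intro h z hz
      obtain ⟨x, hx, h1, h2⟩ := h z
      rw [minF4 hPmin hz] at h2
      have h3 := maxMono hPmax h2
      rw [maxF6 hPmax hx] at h3
      exact le_antisymm h3 h1 ▸ hx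
    · intro h z
      exact ⟨_, h _ (minF5 hn hE hPmin z), maxMono hPmax (minF3 hPmin z), maxF3 hPmax _⟩
  have e56 : (∀ z ∈ MinGen E, Pmax z ∈ E) ↔ {x | Pmax (Pmin x) = x} = E := by
    constructor
    · intro h
      apply Set.Subset.antisymm
      · intro x (hx : Pmax (Pmin x) = x)
        rw [← hx]
        exact h _ (minF5 hn hE hPmin x)
      · intro x hx
        simp only [Set.mem_setOf_eq, minF6 hPmin hx, maxF6 hPmax hx]
    · intro h z hz
      rw [← h]
      apply le_antisymm
      · apply maxMono hPmax
        have := minMono hPmin (maxF3 hPmax z)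
        rwa [minF4 hPmin hz] at this
      · have := maxMono hPmax (minF3 hPmin (Pmax z))
        rwa [maxF4 hPmax (maxF5 hn hE hPmax z)] at this
  have e47 : (∀ z ∈ MaxGen E, Pmin z ∈ E) ↔ {x | Pmin (Pmax x) = x} = E := by
    constructor
    · intro h
      apply Set.Subset.antisymm
      · intro x (hx : Pmin (Pmax x) = x)
        rw [← hx]
        exact h _ (maxF5 hn hE hPmax x)
      · intro x hx
        simp only [Set.mem_setOf_eq, minF6 hPmin hx, maxF6 hPmax hx]
    · intro h z hz
      rw [← h]
      apply le_antisymm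
      · have := minMono hPmin (maxF3 hPmax (Pmin z))
        rwa [minF4 hPmin (minF5 hn hE hPmin z)] at this
      · apply minMono hPmin
        have := maxMono hPmax (minF3 hPmin z)
        rwa [maxF4 hPmax hz] at this
  exact ⟨e13.trans h23.symm, e13, e13.trans e34, e13.trans e35, (e13.trans e35).trans e56,
    (e13.trans e34).trans e47⟩


end Ambitropical
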